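/- arXiv:2408.03141 — 2 statements merged into one kernel-verified Lean document; each statement's English description precedes it below -/
import Mathlib

section
/- Let Γ be a groupoid and R an object unital Γ-graded ring. Then R is right gr-semisimple if and only if R is left gr-semisimple, i.e., the right regular graded module R_R is a sum of gr-simple graded submodules if and only if the left regular graded module _RR is a sum of gr-simple graded submodules. -/
set_option autoImplicit false

noncomputable section

universe u v w x y

/-- A groupoid structure on its set `Γ` of morphisms.  Objects are identified with
the identity morphisms: `src γ` and `tgt γ` are the source and target identities
(`d(γ)` and `r(γ)`), and `comp γ δ h` is the composite `γδ`, which is defined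
exactly when `src γ = tgt δ`. -/
structure Gpd (Γ : Type u) where
  src : Γ → Γ
  tgt : Γ → Γ
  inv : Γ → Γ
  comp : (γ δ : Γ) → src γ = tgt δ → Γ
  src_src : ∀ γ, src (src γ) = src γ
  tgt_src : ∀ γ, tgt (src γ) = src γ
  src_tgt : ∀ γ, src (tgt γ) = tgt γ
  tgt_tgt : ∀ γ, tgt (tgt γ) = tgt γ
  src_comp : ∀ γ δ (h : src γ = tgt δ), src (comp γ δ h) = src δ
  tgt_comp : ∀ γ δ (h : src γ = tgt δ), tgt (comp γ δ h) = tgt γ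
  comp_id : ∀ γ, comp γ (src γ) (tgt_src γ).symm = γ
  id_comp : ∀ γ, comp (tgt γ) γ (src_tgt γ) = γ
  comp_assoc : ∀ γ δ ε (h₁ : src γ = tgt δ) (h₂ : src δ = tgt ε),
    comp (comp γ δ h₁) ε ((src_comp γ δ h₁).trans h₂)
      = comp γ (comp δ ε h₂) (h₁.trans (tgt_comp δ ε h₂).symm)
  src_inv : ∀ γ, src (inv γ) = tgt γ
  tgt_inv : ∀ γ, tgt (inv γ) = src γ
  inv_inv : ∀ γ, inv (inv γ) = γ
  comp_inv : ∀ γ, comp γ (inv γ) (tgt_inv γ).symm = tgt γ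
  inv_comp : ∀ γ, comp (inv γ) γ (src_inv γ) = src γ

namespace Gpd

variable {Γ : Type u} (G : Gpd Γ)

/-- `e` is an object of the groupoid, i.e. an identity morphism. -/
def IsObj (e : Γ) : Prop := G.src e = e

open scoped Classical in
/-- Partial composition: `some (γδ)` when defined, `none` otherwise. -/
def mul? (γ δ : Γ) : Option Γ :=
  if h : G.src γ = G.tgt δ then some (G.comp γ δ h) else none

/-- The partial triple product `σ γ τ⁻¹`, `none` when undefined. -/
def conj? (σ γ τ : Γ) : Option Γ :=
  (G.mul? σ γ).bind fun η => G.mul? η (G.inv τ)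

end Gpd

/-- An object unital `Γ`-graded ring structure on the (possibly non-unital) ring `R`:
a decomposition `R = ⊕ R_γ` with `R_γ R_δ ⊆ R_{γδ}` (zero when `γδ` is undefined),
together with local units `1_e ∈ R_e` for the objects `e` such that
`1_{r(γ)} a = a 1_{d(γ)} = a` for homogeneous `a` of degree `γ`. -/
structure GammaRing {Γ : Type u} (G : Gpd Γ) (R : Type v) [NonUnitalRing R] where
  grade : Γ → AddSubgroup R
  grade_iSup : (⨆ γ : Γ, grade γ) = ⊤
  grade_indep : ∀ γ : Γ, grade γ ⊓ (⨆ (δ : Γ) (_ : δ ≠ γ), grade δ) = ⊥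
  mul_mem : ∀ (γ δ : Γ) (h : G.src γ = G.tgt δ) (a b : R),
    a ∈ grade γ → b ∈ grade δ → a * b ∈ grade (G.comp γ δ h)
  mul_ne : ∀ (γ δ : Γ), G.src γ ≠ G.tgt δ → ∀ (a b : R),
    a ∈ grade γ → b ∈ grade δ → a * b = 0
  one : Γ → R
  one_mem : ∀ e : Γ, G.IsObj e → one e ∈ grade e
  one_mul' : ∀ (γ : Γ) (a : R), a ∈ grade γ → one (G.tgt γ) * a = a
  mul_one' : ∀ (γ : Γ) (a : R), a ∈ grade γ → a * one (G.src γ) = a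

/-- A (unital) `Γ`-graded right module over the object unital `Γ`-graded ring `RG`. -/
structure GammaMod {Γ : Type u} {G : Gpd Γ} {R : Type v} [NonUnitalRing R]
    (RG : GammaRing G R) (M : Type w) [AddCommGroup M] where
  smul : M → R → M
  smul_add : ∀ (m : M) (a b : R), smul m (a + b) = smul m a + smul m b
  add_smul : ∀ (m n : M) (a : R), smul (m + n) a = smul m a + smul n a
  smul_mul : ∀ (m : M) (a b : R), smul m (a * b) = smul (smul m a) b
  grade : Γ → AddSubgroup M
  grade_iSup : (⨆ γ : Γ, grade γ) = ⊤
  grade_indep : ∀ γ : Γ, grade γ ⊓ (⨆ (δ : Γ) (_ : δ ≠ γ), grade δ) = ⊥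
  smul_mem : ∀ (σ τ : Γ) (h : G.src σ = G.tgt τ) (m : M) (a : R),
    m ∈ grade σ → a ∈ RG.grade τ → smul m a ∈ grade (G.comp σ τ h)
  smul_ne : ∀ (σ τ : Γ), G.src σ ≠ G.tgt τ → ∀ (m : M) (a : R),
    m ∈ grade σ → a ∈ RG.grade τ → smul m a = 0
  smul_one : ∀ (σ : Γ) (m : M), m ∈ grade σ → smul m (RG.one (G.src σ)) = m

/-- A (unital) `Γ`-graded left module over the object unital `Γ`-graded ring `RG`. -/
structure GammaLMod {Γ : Type u} {G : Gpd Γ} {R : Type v} [NonUnitalRing R]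
    (RG : GammaRing G R) (M : Type w) [AddCommGroup M] where
  smul : R → M → M
  smul_add : ∀ (a : R) (m n : M), smul a (m + n) = smul a m + smul a n
  add_smul : ∀ (a b : R) (m : M), smul (a + b) m = smul a m + smul b m
  mul_smul : ∀ (a b : R) (m : M), smul (a * b) m = smul a (smul b m)
  grade : Γ → AddSubgroup M
  grade_iSup : (⨆ γ : Γ, grade γ) = ⊤
  grade_indep : ∀ γ : Γ, grade γ ⊓ (⨆ (δ : Γ) (_ : δ ≠ γ), grade δ) = ⊥
  smul_mem : ∀ (τ σ : Γ) (h : G.src τ = G.tgt σ) (a : R) (m : M),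
    a ∈ RG.grade τ → m ∈ grade σ → smul a m ∈ grade (G.comp τ σ h)
  smul_ne : ∀ (τ σ : Γ), G.src τ ≠ G.tgt σ → ∀ (a : R) (m : M),
    a ∈ RG.grade τ → m ∈ grade σ → smul a m = 0
  one_smul : ∀ (σ : Γ) (m : M), m ∈ grade σ → smul (RG.one (G.tgt σ)) m = m

namespace GammaMod

variable {Γ : Type u} {G : Gpd Γ} {R : Type v} [NonUnitalRing R] {RG : GammaRing G R}
  {M : Type w} [AddCommGroup M] (Mod : GammaMod RG M)

/-- `shiftGrade σ γ` is the homogeneous component `M_{σγ}` (zero when undefined):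
the degree-`γ` component of the shifted module `M(σ)`. -/
def shiftGrade (σ γ : Γ) : AddSubgroup M := (G.mul? σ γ).elim ⊥ Mod.grade

/-- `N` is a graded submodule of `M`. -/
def IsGradedSub (N : AddSubgroup M) : Prop :=
  (∀ m ∈ N, ∀ a : R, Mod.smul m a ∈ N) ∧ N ≤ ⨆ γ : Γ, (Mod.grade γ ⊓ N)

/-- `N` is a gr-simple graded submodule of `M`. -/
def IsGrSimpleSub (N : AddSubgroup M) : Prop :=
  Mod.IsGradedSub N ∧ N ≠ ⊥ ∧
    ∀ P : AddSubgroup M, Mod.IsGradedSub P → P ≤ N → P = ⊥ ∨ P = N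

/-- `M` is a gr-simple graded module. -/
def IsGrSimple : Prop := Mod.IsGrSimpleSub ⊤

/-- `M` is a gr-semisimple graded module: it is the sum of its gr-simple graded
submodules. -/
def IsGrSemisimple : Prop :=
  (⨆ (N : AddSubgroup M) (_ : Mod.IsGrSimpleSub N), N) = ⊤

/-- The submodule `M(e) = ⊕_{r(γ) = e} M_γ`. -/
def eComp (e : Γ) : AddSubgroup M := ⨆ (γ : Γ) (_ : G.tgt γ = e), Mod.grade γ

/-- `M` is `Γ₀`-artinian: each `M(e)` satisfies the descending chain condition on
graded submodules. -/
def IsGamma0Artinian : Prop :=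
  ∀ e : Γ, G.IsObj e → ∀ f : ℕ → AddSubgroup M,
    (∀ n, Mod.IsGradedSub (f n) ∧ f n ≤ Mod.eComp e) →
    (∀ n, f (n + 1) ≤ f n) → ∃ n, ∀ k, n ≤ k → f k = f n

/-- `M` is a (nonzero) `Γ₀`-simple module: `M(e)` is gr-simple for every `e ∈ Γ'₀(M)`. -/
def IsGamma0Simple : Prop :=
  (∃ m : M, m ≠ 0) ∧
    ∀ e : Γ, G.IsObj e → Mod.eComp e ≠ ⊥ → Mod.IsGrSimpleSub (Mod.eComp e)

theorem isGradedSub_top : Mod.IsGradedSub (⊤ : AddSubgroup M) := by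
  constructor
  · intro m _ a
    exact AddSubgroup.mem_top _
  · have h : (⨆ γ : Γ, (Mod.grade γ ⊓ (⊤ : AddSubgroup M))) = (⊤ : AddSubgroup M) := by
      simp [Mod.grade_iSup]
    rw [h]

/-- `HomGrade γ` is the homogeneous component `HOM_R(M,M)_γ` of the graded
endomorphism ring `END_R(M)`: the `R`-linear additive endomorphisms `g` with
`g(M_σ) ⊆ M_{γσ}` for all `σ`. -/
def HomGrade (γ : Γ) : Set (M →+ M) :=
  {g | (∀ (m : M) (a : R), g (Mod.smul m a) = Mod.smul (g m) a) ∧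
       ∀ (σ : Γ) (m : M), m ∈ Mod.grade σ → g m ∈ Mod.shiftGrade γ σ}

/-- The graded submodule `N` of `M` is gr-isomorphic to a shift of the graded
submodule `N'` of `M₂`: there are `σ ∈ Γ` and a gr-isomorphism `N ≅ N'(σ)`. -/
def SubIso {M₂ : Type x} [AddCommGroup M₂] (Mod₂ : GammaMod RG M₂)
    (N : AddSubgroup M) (N' : AddSubgroup M₂) (hN : Mod.IsGradedSub N) : Prop :=
  ∃ (σ : Γ) (ψ : N ≃+ N'),
    (∀ (n : N) (a : R),
      ((ψ ⟨Mod.smul n.1 a, hN.1 n.1 n.2 a⟩ : N') : M₂) = Mod₂.smul ((ψ n : N') : M₂) a) ∧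
    ∀ γ : Γ, (fun n : N => ((ψ n : N') : M₂)) '' {n : N | (n : M) ∈ Mod.grade γ}
      = {m : M₂ | m ∈ N' ∧ m ∈ Mod₂.shiftGrade σ γ}

variable {ι : Type y}

/-- A pseudo-linearly independent sequence of homogeneous elements. -/
def PseudoLI (β : ι → Γ) (v : ι → M) : Prop :=
  (∀ i, v i ∈ Mod.grade (β i) ∧ v i ≠ 0) ∧
  ∀ a : ι →₀ R, (∀ i, RG.one (G.src (β i)) * a i = a i) →
    (a.sum fun i r => Mod.smul (v i) r) = 0 → a = 0

/-- A pseudo-basis of `M`: a generating pseudo-linearly independent sequence of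
homogeneous elements. -/
def PseudoBasis (β : ι → Γ) (v : ι → M) : Prop :=
  Mod.PseudoLI β v ∧
    AddSubgroup.closure {m : M | ∃ (i : ι) (r : R), m = Mod.smul (v i) r} = ⊤

/-- `M` is pseudo-free: it has a pseudo-basis. -/
def PseudoFree : Prop :=
  ∃ (κ : Type (max u w)) (β : κ → Γ) (v : κ → M), Mod.PseudoBasis β v

end GammaMod

namespace GammaLMod

variable {Γ : Type u} {G : Gpd Γ} {R : Type v} [NonUnitalRing R] {RG : GammaRing G R}
  {M : Type w} [AddCommGroup M] (Mod : GammaLMod RG M)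

/-- `rshiftGrade σ γ` is the homogeneous component `M_{σγ}` (zero when undefined). -/
def rshiftGrade (σ γ : Γ) : AddSubgroup M := (G.mul? σ γ).elim ⊥ Mod.grade

/-- `N` is a graded left submodule of `M`. -/
def IsGradedSub (N : AddSubgroup M) : Prop :=
  (∀ m ∈ N, ∀ a : R, Mod.smul a m ∈ N) ∧ N ≤ ⨆ γ : Γ, (Mod.grade γ ⊓ N)

def IsGrSimpleSub (N : AddSubgroup M) : Prop :=
  Mod.IsGradedSub N ∧ N ≠ ⊥ ∧
    ∀ P : AddSubgroup M, Mod.IsGradedSub P → P ≤ N → P = ⊥ ∨ P = N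

def IsGrSimple : Prop := Mod.IsGrSimpleSub ⊤

def IsGrSemisimple : Prop :=
  (⨆ (N : AddSubgroup M) (_ : Mod.IsGrSimpleSub N), N) = ⊤

/-- The left submodule `(e)M = ⊕_{d(γ) = e} M_γ`. -/
def lComp (e : Γ) : AddSubgroup M := ⨆ (γ : Γ) (_ : G.src γ = e), Mod.grade γ

def IsGamma0Artinian : Prop :=
  ∀ e : Γ, G.IsObj e → ∀ f : ℕ → AddSubgroup M,
    (∀ n, Mod.IsGradedSub (f n) ∧ f n ≤ Mod.lComp e) →
    (∀ n, f (n + 1) ≤ f n) → ∃ n, ∀ k, n ≤ k → f k = f n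

/-- `V` has finite `Γ₀`-dimension: each `(e)V` has a finite pseudo-basis. -/
def FiniteGamma0Dim : Prop :=
  ∀ e : Γ, G.IsObj e → ∃ (n : ℕ) (γs : Fin n → Γ) (u : Fin n → M),
    (∀ i, G.src (γs i) = e ∧ u i ∈ Mod.grade (γs i) ∧ u i ≠ 0) ∧
    (∀ m ∈ Mod.lComp e,
      m ∈ AddSubgroup.closure {y : M | ∃ (i : Fin n) (a : R), y = Mod.smul a (u i)}) ∧
    ∀ a : Fin n → R, (∀ i, a i * RG.one (G.tgt (γs i)) = a i) →
      (∑ i, Mod.smul (a i) (u i)) = 0 → ∀ i, a i = 0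

end GammaLMod

namespace GammaRing

variable {Γ : Type u} {G : Gpd Γ} {R : Type v} [NonUnitalRing R] (RG : GammaRing G R)

/-- The (right) regular graded module `R_R`. -/
def regular : GammaMod RG R where
  smul := fun m a => m * a
  smul_add := fun m a b => mul_add m a b
  add_smul := fun m n a => add_mul m n a
  smul_mul := fun m a b => (mul_assoc m a b).symm
  grade := RG.grade
  grade_iSup := RG.grade_iSup
  grade_indep := RG.grade_indep
  smul_mem := RG.mul_mem
  smul_ne := RG.mul_ne
  smul_one := RG.mul_one'

/-- The left regular graded module `_R R`. -/
def leftRegular : GammaLMod RG R where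
  smul := fun a m => a * m
  smul_add := fun a m n => mul_add a m n
  add_smul := fun a b m => add_mul a b m
  mul_smul := fun a b m => mul_assoc a b m
  grade := RG.grade
  grade_iSup := RG.grade_iSup
  grade_indep := RG.grade_indep
  smul_mem := RG.mul_mem
  smul_ne := RG.mul_ne
  one_smul := RG.one_mul'

/-- `I` is a graded (two-sided) ideal of `R`. -/
def IsGradedIdeal (I : AddSubgroup R) : Prop :=
  (∀ a ∈ I, ∀ r : R, a * r ∈ I ∧ r * a ∈ I) ∧ I ≤ ⨆ γ : Γ, (RG.grade γ ⊓ I)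

/-- `R` is a gr-simple ring. -/
def IsGrSimpleRing : Prop :=
  (∃ a : R, a ≠ 0) ∧ ∀ I : AddSubgroup R, RG.IsGradedIdeal I → I = ⊥ ∨ I = ⊤

/-- `R` is a gr-prime ring. -/
def IsGrPrime : Prop :=
  (∃ a : R, a ≠ 0) ∧ ∀ I J : AddSubgroup R, RG.IsGradedIdeal I → RG.IsGradedIdeal J →
    I ≠ ⊥ → J ≠ ⊥ → ∃ a ∈ I, ∃ b ∈ J, a * b ≠ 0

/-- `R` is a `Γ`-graded division ring: `R ≠ 0` and every nonzero homogeneous element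
of degree `γ` has an inverse of degree `γ⁻¹`. -/
def IsGrDivision : Prop :=
  (∃ a : R, a ≠ 0) ∧ ∀ (γ : Γ) (a : R), a ∈ RG.grade γ → a ≠ 0 →
    ∃ b ∈ RG.grade (G.inv γ), a * b = RG.one (G.tgt γ) ∧ b * a = RG.one (G.src γ)

/-- `supp(R) ⊆ eΓe`. -/
def SuppLE (e : Γ) : Prop := ∀ γ : Γ, RG.grade γ ≠ ⊥ → G.src γ = e ∧ G.tgt γ = e

def IsRightGrSemisimple : Prop := RG.regular.IsGrSemisimple

def IsLeftGrSemisimple : Prop := RG.leftRegular.IsGrSemisimple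

def IsRightGamma0Artinian : Prop := RG.regular.IsGamma0Artinian

def IsLeftGamma0Artinian : Prop := RG.leftRegular.IsGamma0Artinian

/-- The component ring `R_e` is a division ring with identity `1_e`. -/
def ComponentDivisionRing (e : Γ) : Prop :=
  RG.one e ≠ 0 ∧ ∀ a ∈ RG.grade e, a ≠ 0 →
    ∃ b ∈ RG.grade e, a * b = RG.one e ∧ b * a = RG.one e

/-- The additive subgroup `N` of `R` is, with the induced structure, a gr-simple
graded ring. -/
def SubringGrSimple (N : AddSubgroup R) : Prop :=
  N ≠ ⊥ ∧ ∀ P : AddSubgroup R,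
    (P ≤ N ∧ (∀ p ∈ P, ∀ n ∈ N, p * n ∈ P ∧ n * p ∈ P) ∧
      P ≤ ⨆ γ : Γ, (RG.grade γ ⊓ P)) →
    P = ⊥ ∨ P = N

/-- The additive subgroup `N` of `R` is, with the induced structure, a gr-prime
graded ring. -/
def SubringGrPrime (N : AddSubgroup R) : Prop :=
  (∃ a ∈ N, a ≠ 0) ∧ ∀ P Q : AddSubgroup R,
    (P ≤ N ∧ (∀ p ∈ P, ∀ n ∈ N, p * n ∈ P ∧ n * p ∈ P) ∧
      P ≤ ⨆ γ : Γ, (RG.grade γ ⊓ P)) →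
    (Q ≤ N ∧ (∀ q ∈ Q, ∀ n ∈ N, q * n ∈ Q ∧ n * q ∈ Q) ∧
      Q ≤ ⨆ γ : Γ, (RG.grade γ ⊓ Q)) →
    P ≠ ⊥ → Q ≠ ⊥ → ∃ p ∈ P, ∃ q ∈ Q, p * q ≠ 0

/-- The additive subgroup `N` of `R` is, with the induced structure, a graded
division ring. -/
def SubringGrDivision (N : AddSubgroup R) : Prop :=
  (∃ a ∈ N, a ≠ 0) ∧ ∀ (γ : Γ) (a : R), a ∈ RG.grade γ → a ∈ N → a ≠ 0 →
    RG.one (G.tgt γ) ∈ N ∧ RG.one (G.src γ) ∈ N ∧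
    ∃ b ∈ RG.grade (G.inv γ), b ∈ N ∧ a * b = RG.one (G.tgt γ) ∧ b * a = RG.one (G.src γ)

/-- The additive subgroup `N` of `R` is, with the induced structure, a right
`Γ₀`-artinian graded ring. -/
def SubringRightGamma0Artinian (N : AddSubgroup R) : Prop :=
  ∀ e : Γ, G.IsObj e → ∀ f : ℕ → AddSubgroup R,
    (∀ n, f n ≤ N ⊓ RG.regular.eComp e ∧ (∀ p ∈ f n, ∀ x ∈ N, p * x ∈ f n) ∧
      f n ≤ ⨆ γ : Γ, (RG.grade γ ⊓ f n)) →
    (∀ n, f (n + 1) ≤ f n) → ∃ n, ∀ k, n ≤ k → f k = f n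

end GammaRing

/-- A bundled object unital `Γ`-graded ring. -/
structure BRing.{u', v'} {Γ : Type u'} (G : Gpd Γ) where
  carrier : Type v'
  [ring : NonUnitalRing carrier]
  str : GammaRing G carrier

attribute [instance] BRing.ring

/-- A bundled `Γ`-graded right module over `RG`. -/
structure BMod.{u', v', w'} {Γ : Type u'} {G : Gpd Γ} {R : Type v'} [NonUnitalRing R]
    (RG : GammaRing G R) where
  carrier : Type w'
  [acg : AddCommGroup carrier]
  str : GammaMod RG carrier

attribute [instance] BMod.acg

/-- Two bundled graded modules are in the same isoshift class. -/
def BModSameClass {Γ : Type u} {G : Gpd Γ} {R : Type v} [NonUnitalRing R]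
    {RG : GammaRing G R} (S T : BMod.{u, v, w} RG) : Prop :=
  S.str.SubIso T.str ⊤ ⊤ S.str.isGradedSub_top

/-- The isoshiftical component of `R` of the type of the graded module `S`:
the sum of all graded right ideals of `R` which are gr-simple and lie in the
isoshift class of `S`. -/
def GammaRing.isoComponent {Γ : Type u} {G : Gpd Γ} {R : Type v} [NonUnitalRing R]
    (RG : GammaRing G R) (S : BMod.{u, v, w} RG) : AddSubgroup R :=
  ⨆ (N : AddSubgroup R) (_ : RG.regular.IsGrSimpleSub N ∧
      ∃ hN : RG.regular.IsGradedSub N, RG.regular.SubIso S.str N ⊤ hN), N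

/-- `R` is a pseudo-free module ring: every `Γ`-graded right `R`-module is
pseudo-free. -/
def GammaRing.IsPfm.{u', v', w'} {Γ : Type u'} {G : Gpd Γ} {R : Type v'}
    [NonUnitalRing R] (RG : GammaRing G R) : Prop :=
  ∀ S : BMod.{u', v', w'} RG, S.str.PseudoFree

/-- `R` has invariant pseudo-basis number: any two pseudo-bases of a finitely
generated pseudo-free graded module have the same number of elements. -/
def GammaRing.IPBN.{u', v', w'} {Γ : Type u'} {G : Gpd Γ} {R : Type v'}
    [NonUnitalRing R] (RG : GammaRing G R) : Prop :=
  ∀ (S : BMod.{u', v', w'} RG) (m n : ℕ) (β₁ : Fin m → Γ) (v₁ : Fin m → S.carrier)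
    (β₂ : Fin n → Γ) (v₂ : Fin n → S.carrier),
    S.str.PseudoBasis β₁ v₁ → S.str.PseudoBasis β₂ v₂ → m = n

/-- A `d`-finite sequence of elements of `eΓ`. -/
def DFiniteSeq {Γ : Type u} (G : Gpd Γ) {I : Type w} (e : Γ) (σ : I → Γ) : Prop :=
  (∀ i, G.tgt (σ i) = e) ∧ ∀ f : Γ, {i : I | G.src (σ i) = f}.Finite

/-- The degree-`γ` constraint on the `(i,j)` entry of a homogeneous matrix:
the component `D_{σ_i γ σ_j⁻¹}` (zero when the product is undefined). -/
def entryGrade {Γ : Type u} (G : Gpd Γ) {D : Type v} [NonUnitalRing D]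
    (DG : GammaRing G D) {I : Type w} (σ : I → Γ) (γ : Γ) (i j : I) : AddSubgroup D :=
  (G.conj? (σ i) γ (σ j)).elim ⊥ DG.grade

/-- The `(i,j)` entry of the product of two finitely supported matrices. -/
def matMulEntry {I : Type w} {D : Type v} [NonUnitalRing D]
    (A B : I →₀ I →₀ D) (i j : I) : D :=
  (A i).sum fun k a => a * B k j

/-- `R` is gr-isomorphic to the graded matrix ring `M_I(D)(σ̄)`: there is an
injective additive map from `R` to the finitely supported `I×I` matrices over `D`
which respects matrix multiplication and maps the homogeneous component `R_γ` onto
the set of homogeneous matrices of degree `γ`. -/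
def GammaRing.GrRepMatrix {Γ : Type u} {G : Gpd Γ} {R : Type v} {D : Type x}
    [NonUnitalRing R] [NonUnitalRing D] (RG : GammaRing G R) (DG : GammaRing G D)
    {I : Type w} (σ : I → Γ) : Prop :=
  ∃ φ : R →+ (I →₀ I →₀ D), Function.Injective φ ∧
    (∀ (a b : R) (i j : I), φ (a * b) i j = matMulEntry (φ a) (φ b) i j) ∧
    ∀ γ : Γ, (fun r : R => φ r) '' (RG.grade γ : Set R)
      = {m : I →₀ I →₀ D | ∀ i j : I, m i j ∈ entryGrade G DG σ γ i j}

/-- Entry constraint for matrix rings indexed by a sequence of subsets of `Γ`: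
the component `D_{Σ_i γ Σ_j⁻¹}`. -/
def entryGradeSet {Γ : Type u} (G : Gpd Γ) {D : Type v} [NonUnitalRing D]
    (DG : GammaRing G D) {I : Type w} (Sig : I → Set Γ) (γ : Γ) (i j : I) :
    AddSubgroup D :=
  ⨆ (σ : Γ) (_ : σ ∈ Sig i) (τ : Γ) (_ : τ ∈ Sig j), (G.conj? σ γ τ).elim ⊥ DG.grade

/-- `R` is gr-isomorphic to the graded matrix ring `M_I(D)(Σ̄)` for a sequence of
subsets `Σ̄`. -/
def GammaRing.GrRepMatrixSet {Γ : Type u} {G : Gpd Γ} {R : Type v} {D : Type x}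
    [NonUnitalRing R] [NonUnitalRing D] (RG : GammaRing G R) (DG : GammaRing G D)
    {I : Type w} (Sig : I → Set Γ) : Prop :=
  ∃ φ : R →+ (I →₀ I →₀ D), Function.Injective φ ∧
    (∀ (a b : R) (i j : I), φ (a * b) i j = matMulEntry (φ a) (φ b) i j) ∧
    ∀ γ : Γ, (fun r : R => φ r) '' (RG.grade γ : Set R)
      = {m : I →₀ I →₀ D | ∀ i j : I, m i j ∈ entryGradeSet G DG Sig γ i j}

/-- The family of graded rings `Rj` is summable. -/
def SummableFam {Γ : Type u} {G : Gpd Γ} {J : Type w} (Rj : J → BRing.{u, x} G) : Prop :=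
  ∀ e : Γ, G.IsObj e → {j : J | (Rj j).str.grade e ≠ ⊥}.Finite

/-- `P` (with projections `π`) is the graded direct product `∏^gr_j R_j`. -/
def IsGradedProductB {Γ : Type u} {G : Gpd Γ} {J : Type w} (Rj : J → BRing.{u, x} G)
    {P : Type v} [NonUnitalRing P] (PG : GammaRing G P)
    (π : ∀ j, P →+ (Rj j).carrier) : Prop :=
  (∀ (j : J) (a b : P), π j (a * b) = π j a * π j b) ∧
  (∀ (j : J) (e : Γ), G.IsObj e → π j (PG.one e) = (Rj j).str.one e) ∧
  ∀ (γ : Γ) (xs : ∀ j, (Rj j).carrier), (∀ j, xs j ∈ (Rj j).str.grade γ) →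
    ∃! p : P, p ∈ PG.grade γ ∧ ∀ j, π j p = xs j

/-- `R` and `S` are gr-isomorphic graded rings. -/
def GrIso {Γ : Type u} {G : Gpd Γ} {R : Type v} {S : Type x}
    [NonUnitalRing R] [NonUnitalRing S] (RG : GammaRing G R) (SG : GammaRing G S) :
    Prop :=
  ∃ φ : R ≃+ S, (∀ a b : R, φ (a * b) = φ a * φ b) ∧
    (∀ e : Γ, G.IsObj e → φ (RG.one e) = SG.one e) ∧
    ∀ γ : Γ, (fun a : R => φ a) '' (RG.grade γ : Set R) = (SG.grade γ : Set S)

/-- The gr-primality relation: `1_e D 1_f ≠ 0`. -/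
def GrPrimRel {Γ : Type u} (G : Gpd Γ) {D : Type v} [NonUnitalRing D]
    (DG : GammaRing G D) (e f : Γ) : Prop :=
  ∃ x : D, DG.one e * x * DG.one f ≠ 0

/-- The graded ideal `D_{[e]}` attached to the `∼`-class of `e`. -/
def ClassIdeal {Γ : Type u} (G : Gpd Γ) {D : Type v} [NonUnitalRing D]
    (DG : GammaRing G D) (e : Γ) : AddSubgroup D :=
  ⨆ (γ : Γ) (_ : GrPrimRel G DG (G.tgt γ) e ∧ GrPrimRel G DG (G.src γ) e), DG.grade γ

end
universe u v w x y


theorem AddSubgroup.exists_projections {ι : Type*} {M : Type*} [AddCommGroup M]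
    (A : ι → AddSubgroup M) (hs : (⨆ i, A i) = ⊤)
    (hi : ∀ i, A i ⊓ (⨆ (j : ι) (_ : j ≠ i), A j) = ⊥) :
    ∃ p : ι → M →+ M, (∀ i m, p i m ∈ A i) ∧ (∀ i, ∀ m ∈ A i, p i m = m) ∧
      (∀ i j, i ≠ j → ∀ m ∈ A j, p i m = 0) ∧ ∀ m, ∃ s : Finset ι, m = ∑ i ∈ s, p i m := by
  classical
  have hind : iSupIndep A := fun i => disjoint_iff.2 (hi i)
  have hint : DirectSum.IsInternal A := by
    refine ⟨hind.dfinsuppSumAddHom_injective, ?_⟩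
    have hle : (⨆ i, A i) ≤ (DirectSum.coeAddMonoidHom A).range :=
      iSup_le fun i m hm => ⟨DirectSum.of (fun i => A i) i ⟨m, hm⟩, by simp⟩
    intro m
    exact hle (hs ▸ AddSubgroup.mem_top m)
  let _ : DirectSum.Decomposition A := hint.chooseDecomposition
  refine ⟨fun i =>
    { toFun := fun m => (DirectSum.decompose A m i : M)
      map_zero' := by simp
      map_add' := by simp }, fun i m => ?_, fun i m hm => ?_, fun i j hij m hm => ?_, fun m => ?_⟩
  · exact (DirectSum.decompose A m i).2
  · exact DirectSum.decompose_of_mem_same A hm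
  · exact DirectSum.decompose_of_mem_ne A hm hij.symm
  · exact ⟨_, (DirectSum.sum_support_decompose A m).symm⟩

namespace Gpd

variable {Γ : Type u} (G : Gpd Γ)

theorem comp_congr {γ γ' δ δ' : Γ} (hγ : γ = γ') (hδ : δ = δ') (h : G.src γ = G.tgt δ) :
    G.comp γ δ h = G.comp γ' δ' (hγ ▸ hδ ▸ h) := by
  subst hγ hδ
  rfl

theorem inv_comp_cancel_left (γ δ : Γ) (h : G.src γ = G.tgt δ) :
    G.comp (G.inv γ) (G.comp γ δ h) ((G.src_inv γ).trans (G.tgt_comp γ δ h).symm) = δ := by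
  rw [← G.comp_assoc (G.inv γ) γ δ (G.src_inv γ) h, G.comp_congr ((G.inv_comp γ).trans h) rfl]
  exact G.id_comp δ

theorem comp_left_cancel {γ δ ε : Γ} (hδ : G.src γ = G.tgt δ) (hε : G.src γ = G.tgt ε)
    (h : G.comp γ δ hδ = G.comp γ ε hε) : δ = ε := by
  rw [← G.inv_comp_cancel_left γ δ hδ, ← G.inv_comp_cancel_left γ ε hε]
  exact G.comp_congr rfl h _

theorem comp_inv_cancel_right (ρ γ : Γ) (h : G.src ρ = G.src γ) :
    G.comp (G.comp ρ (G.inv γ) (h.trans (G.tgt_inv γ).symm)) γ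
      ((G.src_comp _ _ _).trans (G.src_inv γ)) = ρ := by
  rw [G.comp_assoc ρ (G.inv γ) γ _ (G.src_inv γ), G.comp_congr rfl ((G.inv_comp γ).trans h.symm)]
  exact G.comp_id ρ

/-- The opposite groupoid, on the same set of morphisms. -/
def op : Gpd Γ where
  src := G.tgt
  tgt := G.src
  inv := G.inv
  comp γ δ h := G.comp δ γ h.symm
  src_src := G.tgt_tgt
  tgt_src := G.src_tgt
  src_tgt := G.tgt_src
  tgt_tgt := G.src_src
  src_comp _ _ _ := G.tgt_comp _ _ _
  tgt_comp _ _ _ := G.src_comp _ _ _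
  comp_id := G.id_comp
  id_comp := G.comp_id
  comp_assoc _ _ _ h₁ h₂ := (G.comp_assoc _ _ _ h₂.symm h₁.symm).symm
  src_inv := G.tgt_inv
  tgt_inv := G.src_inv
  inv_inv := G.inv_inv
  comp_inv := G.inv_comp
  inv_comp := G.comp_inv

end Gpd

/-- The opposite ring structure on the same additive group. -/
@[reducible]
def NonUnitalRing.opposite (R : Type v) [NonUnitalRing R] : NonUnitalRing R :=
  { (inferInstance : AddCommGroup R) with
    mul := fun a b => b * a
    left_distrib := fun a b c => add_mul b c a
    right_distrib := fun a b c => mul_add c a b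
    zero_mul := fun a => mul_zero a
    mul_zero := fun a => zero_mul a
    mul_assoc := fun a b c => (mul_assoc c b a).symm }

namespace GammaRing

variable {Γ : Type u} {G : Gpd Γ} {R : Type v} [NonUnitalRing R] (RG : GammaRing G R)

/-- The opposite graded ring, graded by the opposite groupoid. -/
def op : @GammaRing Γ G.op R (NonUnitalRing.opposite R) :=
  @GammaRing.mk Γ G.op R (NonUnitalRing.opposite R) RG.grade RG.grade_iSup RG.grade_indep
    (fun γ δ h a b ha hb => RG.mul_mem δ γ h.symm b a hb ha)
    (fun γ δ h a b ha hb => RG.mul_ne δ γ (Ne.symm h) b a hb ha)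
    RG.one
    (fun e he => RG.one_mem e (by
      have h : G.tgt e = e := he
      have := G.src_tgt e
      rwa [h] at this))
    RG.mul_one' RG.one_mul'

/-- The projection of `R` onto its homogeneous component of degree `γ`. -/
noncomputable def proj (γ : Γ) : R →+ R :=
  (AddSubgroup.exists_projections RG.grade RG.grade_iSup RG.grade_indep).choose γ

theorem proj_mem (γ : Γ) (m : R) : RG.proj γ m ∈ RG.grade γ :=
  (AddSubgroup.exists_projections RG.grade RG.grade_iSup RG.grade_indep).choose_spec.1 γ m

theorem proj_of_mem {γ : Γ} {m : R} (hm : m ∈ RG.grade γ) : RG.proj γ m = m :=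
  (AddSubgroup.exists_projections RG.grade RG.grade_iSup RG.grade_indep).choose_spec.2.1 γ m hm

theorem proj_of_mem_ne {γ δ : Γ} (h : γ ≠ δ) {m : R} (hm : m ∈ RG.grade δ) : RG.proj γ m = 0 :=
  (AddSubgroup.exists_projections RG.grade RG.grade_iSup
    RG.grade_indep).choose_spec.2.2.1 γ δ h m hm

theorem exists_eq_sum_proj (m : R) : ∃ s : Finset Γ, m = ∑ γ ∈ s, RG.proj γ m :=
  (AddSubgroup.exists_projections RG.grade RG.grade_iSup RG.grade_indep).choose_spec.2.2.2 m

theorem homogeneous_induction {motive : R → Prop} (m : R)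
    (mem : ∀ γ, ∀ m ∈ RG.grade γ, motive m) (zero : motive 0)
    (add : ∀ m n, motive m → motive n → motive (m + n)) : motive m :=
  AddSubgroup.iSup_induction RG.grade (C := motive) (RG.grade_iSup ▸ AddSubgroup.mem_top m) mem zero add

theorem le_iSup_grade_inf_iff (N : AddSubgroup R) :
    N ≤ ⨆ γ : Γ, (RG.grade γ ⊓ N) ↔ ∀ m ∈ N, ∀ γ, RG.proj γ m ∈ N := by
  constructor
  · intro h m hm γ
    refine AddSubgroup.iSup_induction (fun γ => RG.grade γ ⊓ N)
      (C := fun m => RG.proj γ m ∈ N) (h hm) ?_ ?_ ?_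
    · intro δ n hn
      by_cases hγ : γ = δ
      · subst hγ
        rw [RG.proj_of_mem hn.1]
        exact hn.2
      · rw [RG.proj_of_mem_ne hγ hn.1]
        exact N.zero_mem
    · simp
    · intro a b ha hb
      rw [map_add]
      exact N.add_mem ha hb
  · intro h m hm
    obtain ⟨s, hs⟩ := RG.exists_eq_sum_proj m
    rw [hs]
    exact AddSubgroup.sum_mem _ fun γ _ =>
      AddSubgroup.mem_iSup_of_mem γ ⟨RG.proj_mem γ m, h m hm γ⟩

theorem regular_isGradedSub_iff (N : AddSubgroup R) :
    RG.regular.IsGradedSub N ↔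
      (∀ m ∈ N, ∀ a : R, m * a ∈ N) ∧ ∀ m ∈ N, ∀ γ, RG.proj γ m ∈ N :=
  and_congr Iff.rfl (RG.le_iSup_grade_inf_iff N)

theorem leftRegular_isGradedSub_iff (N : AddSubgroup R) :
    RG.leftRegular.IsGradedSub N ↔
      (∀ m ∈ N, ∀ a : R, a * m ∈ N) ∧ ∀ m ∈ N, ∀ γ, RG.proj γ m ∈ N :=
  and_congr Iff.rfl (RG.le_iSup_grade_inf_iff N)

theorem exists_proj_ne_zero {m : R} (hm : m ≠ 0) : ∃ γ, RG.proj γ m ≠ 0 := by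
  by_contra! h
  obtain ⟨s, hs⟩ := RG.exists_eq_sum_proj m
  exact hm (hs.trans (Finset.sum_eq_zero fun γ _ => h γ))

theorem mem_mulLeft_range {γ : Γ} {a : R} (ha : a ∈ RG.grade γ) :
    a ∈ (AddMonoidHom.mulLeft a).range :=
  ⟨RG.one (G.src γ), RG.mul_one' γ a ha⟩

theorem mem_mulRight_range {γ : Γ} {a : R} (ha : a ∈ RG.grade γ) :
    a ∈ (AddMonoidHom.mulRight a).range :=
  ⟨RG.one (G.tgt γ), RG.one_mul' γ a ha⟩

theorem proj_mul_mem_of_mem {γ δ : Γ} {a b : R} (ha : a ∈ RG.grade γ) (hb : b ∈ RG.grade δ)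
    (η : Γ) {N : AddSubgroup R} (h : a * b ∈ N) : RG.proj η (a * b) ∈ N := by
  by_cases hc : G.src γ = G.tgt δ
  · have hab := RG.mul_mem γ δ hc a b ha hb
    by_cases hη : η = G.comp γ δ hc
    · subst hη
      rwa [RG.proj_of_mem hab]
    · rw [RG.proj_of_mem_ne hη hab]
      exact N.zero_mem
  · rw [RG.mul_ne γ δ hc a b ha hb, map_zero]
    exact N.zero_mem

theorem isGradedSub_mulLeft_range {γ : Γ} {a : R} (ha : a ∈ RG.grade γ) :
    RG.regular.IsGradedSub (AddMonoidHom.mulLeft a).range := by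
  refine (RG.regular_isGradedSub_iff _).2 ⟨?_, ?_⟩
  · rintro _ ⟨y, rfl⟩ b
    exact ⟨y * b, (mul_assoc a y b).symm⟩
  · rintro _ ⟨y, rfl⟩ η
    refine RG.homogeneous_induction
      (motive := fun y => RG.proj η (a * y) ∈ (AddMonoidHom.mulLeft a).range) y ?_ ?_ ?_
    · exact fun τ y hy => RG.proj_mul_mem_of_mem ha hy η ⟨y, rfl⟩
    · simp only [mul_zero, map_zero, zero_mem]
    · intro m n hm hn
      rw [mul_add, map_add]
      exact add_mem hm hn

theorem isGradedSub_mulRight_range {γ : Γ} {a : R} (ha : a ∈ RG.grade γ) :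
    RG.leftRegular.IsGradedSub (AddMonoidHom.mulRight a).range := by
  refine (RG.leftRegular_isGradedSub_iff _).2 ⟨?_, ?_⟩
  · rintro _ ⟨y, rfl⟩ b
    exact ⟨b * y, mul_assoc b y a⟩
  · rintro _ ⟨y, rfl⟩ η
    refine RG.homogeneous_induction
      (motive := fun y => RG.proj η (y * a) ∈ (AddMonoidHom.mulRight a).range) y ?_ ?_ ?_
    · exact fun τ y hy => RG.proj_mul_mem_of_mem hy ha η ⟨y, rfl⟩
    · simp only [zero_mul, map_zero, zero_mem]
    · intro m n hm hn
      rw [add_mul, map_add]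
      exact add_mem hm hn

/-- The ring of additive endomorphisms of `R` generated by right multiplications and
homogeneous projections. Its submodules of `R` are the graded right ideals. -/
def gradedEnd : Subring (AddMonoid.End R) :=
  Subring.closure (Set.range (fun a : R => (AddMonoidHom.mulRight a : AddMonoid.End R)) ∪
    Set.range (fun γ => (RG.proj γ : AddMonoid.End R)))

/-- A graded right ideal as a submodule over `gradedEnd`. -/
def toSubmodule (N : AddSubgroup R) (hN : RG.regular.IsGradedSub N) :
    Submodule RG.gradedEnd R where
  __ := N
  smul_mem' := by
    rintro ⟨f, hf⟩ m hm
    change f m ∈ N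
    replace hm : m ∈ N := hm
    obtain ⟨hmul, hproj⟩ := (RG.regular_isGradedSub_iff N).1 hN
    induction hf using Subring.closure_induction generalizing m with
    | mem f hf =>
      rcases hf with ⟨a, rfl⟩ | ⟨γ, rfl⟩
      · exact hmul m hm a
      · exact hproj m hm γ
    | zero => exact N.zero_mem
    | one => exact hm
    | add f g _ _ hf hg => exact N.add_mem (hf hm) (hg hm)
    | neg f _ hf => exact N.neg_mem (hf hm)
    | mul f g _ _ hf hg => exact hf (hg hm)

theorem isGradedSub_toAddSubgroup (N : Submodule RG.gradedEnd R) :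
    RG.regular.IsGradedSub N.toAddSubgroup := by
  refine (RG.regular_isGradedSub_iff _).2 ⟨fun m hm a => ?_, fun m hm γ => ?_⟩
  · exact N.smul_mem (⟨_, Subring.subset_closure (Or.inl ⟨a, rfl⟩)⟩ : RG.gradedEnd) hm
  · exact N.smul_mem (⟨_, Subring.subset_closure (Or.inr ⟨γ, rfl⟩)⟩ : RG.gradedEnd) hm

theorem isSimpleModule_toSubmodule {N : AddSubgroup R} (hN : RG.regular.IsGrSimpleSub N) :
    IsSimpleModule RG.gradedEnd (RG.toSubmodule N hN.1) := by
  rw [isSimpleModule_iff_isAtom]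
  refine ⟨fun h => hN.2.1 ?_, fun P hP => ?_⟩
  · exact congrArg Submodule.toAddSubgroup h
  · rcases hN.2.2 P.toAddSubgroup (RG.isGradedSub_toAddSubgroup P) hP.le with h | h
    · exact Submodule.toAddSubgroup_injective h
    · exact absurd (Submodule.toAddSubgroup_injective (h : P.toAddSubgroup =
        (RG.toSubmodule N hN.1).toAddSubgroup)) hP.ne

variable {RG}

theorem IsRightGrSemisimple.isSemisimpleModule (h : RG.IsRightGrSemisimple) :
    IsSemisimpleModule RG.gradedEnd R := by
  apply IsSemisimpleModule.of_sSup_simples_eq_top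
  apply Submodule.toAddSubgroup_injective
  refine top_le_iff.1 (h.symm.le.trans (iSup₂_le fun N hN => ?_))
  exact (Submodule.toAddSubgroup_le _ _).2
    (le_sSup (RG.isSimpleModule_toSubmodule hN) : RG.toSubmodule N hN.1 ≤ _)

theorem IsRightGrSemisimple.exists_complement (h : RG.IsRightGrSemisimple) {N : AddSubgroup R}
    (hN : RG.regular.IsGradedSub N) :
    ∃ Q : AddSubgroup R, RG.regular.IsGradedSub Q ∧ (∀ m ∈ N, m ∈ Q → m = 0) ∧
      ∀ m : R, ∃ a ∈ N, ∃ b ∈ Q, a + b = m := by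
  have := h.isSemisimpleModule
  obtain ⟨Q, hQ⟩ := exists_isCompl (RG.toSubmodule N hN)
  refine ⟨Q.toAddSubgroup, RG.isGradedSub_toAddSubgroup Q, ?_, ?_⟩
  · exact fun m hm hm' => Submodule.disjoint_def.1 hQ.disjoint m hm hm'
  · intro m
    have hm : m ∈ RG.toSubmodule N hN ⊔ Q := hQ.sup_eq_top ▸ Submodule.mem_top
    exact Submodule.mem_sup.1 hm

/-- A right gr-semisimple ring is graded von Neumann regular. -/
theorem IsRightGrSemisimple.exists_mul_mul_eq (h : RG.IsRightGrSemisimple) {γ : Γ} {a : R}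
    (ha : a ∈ RG.grade γ) : ∃ b ∈ RG.grade (G.inv γ), a * b * a = a := by
  obtain ⟨Q, hQ, hdisj, hsum⟩ := h.exists_complement (RG.isGradedSub_mulLeft_range ha)
  obtain ⟨hmul, hproj⟩ := (RG.regular_isGradedSub_iff Q).1 hQ
  obtain ⟨_, ⟨y, rfl⟩, v, hv, huv⟩ := hsum (RG.one (G.tgt γ))
  have key : ∀ y, RG.proj (G.tgt γ) (a * y) = a * RG.proj (G.inv γ) y := by
    intro y
    refine RG.homogeneous_induction
      (motive := fun y => RG.proj (G.tgt γ) (a * y) = a * RG.proj (G.inv γ) y) y ?_ ?_ ?_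
    · intro τ y hy
      by_cases hc : G.src γ = G.tgt τ
      · have hay := RG.mul_mem γ τ hc a y ha hy
        by_cases hτ : G.inv γ = τ
        · subst hτ
          rw [G.comp_inv] at hay
          rw [RG.proj_of_mem hay, RG.proj_of_mem hy]
        · rw [RG.proj_of_mem_ne hτ hy, mul_zero, RG.proj_of_mem_ne _ hay]
          intro heq
          exact hτ (G.comp_left_cancel (G.tgt_inv γ).symm hc ((G.comp_inv γ).trans heq))
      · rw [RG.mul_ne γ τ hc a y ha hy, map_zero, RG.proj_of_mem_ne _ hy, mul_zero]
        rintro rfl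
        exact hc (G.tgt_inv γ).symm
    · simp only [mul_zero, map_zero]
    · intro m n hm hn
      rw [mul_add, map_add, hm, hn, map_add, mul_add]
  refine ⟨RG.proj (G.inv γ) y, RG.proj_mem _ _, ?_⟩
  have hone := congrArg (RG.proj (G.tgt γ)) huv
  rw [map_add, RG.proj_of_mem (RG.one_mem _ (G.src_tgt γ)), AddMonoidHom.coe_mulLeft, key] at hone
  have h1 := congrArg (· * a) hone
  simp only [add_mul, RG.one_mul' γ a ha] at h1
  have h2 : RG.proj (G.tgt γ) v * a = 0 := by
    refine hdisj _ ?_ (hmul _ (hproj v hv _) a)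
    rw [eq_sub_of_add_eq' h1]
    exact sub_mem (RG.mem_mulLeft_range ha) ⟨RG.proj (G.inv γ) y * a, (mul_assoc _ _ _).symm⟩
  rwa [h2, add_zero] at h1

theorem mulLeft_range_eq_of_isGrSimpleSub {N : AddSubgroup R} (hN : RG.regular.IsGrSimpleSub N)
    {γ : Γ} {a : R} (ha : a ∈ RG.grade γ) (haN : a ∈ N) (ha0 : a ≠ 0) :
    (AddMonoidHom.mulLeft a).range = N := by
  refine (hN.2.2 _ (RG.isGradedSub_mulLeft_range ha) ?_).resolve_left ?_
  · rintro _ ⟨y, rfl⟩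
    exact hN.1.1 a haN y
  · intro hbot
    exact ha0 (AddSubgroup.mem_bot.1 (hbot ▸ RG.mem_mulLeft_range ha))

theorem IsRightGrSemisimple.isGrSimpleSub_mulRight_range (h : RG.IsRightGrSemisimple)
    {N : AddSubgroup R} (hN : RG.regular.IsGrSimpleSub N) {ρ : Γ} {g : R}
    (hg : g ∈ RG.grade ρ) (hgN : g ∈ N) (hg0 : g ≠ 0) :
    RG.leftRegular.IsGrSimpleSub (AddMonoidHom.mulRight g).range := by
  refine ⟨RG.isGradedSub_mulRight_range hg, fun hbot => ?_, fun P hP hle => ?_⟩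
  · exact hg0 (AddSubgroup.mem_bot.1 (hbot ▸ RG.mem_mulRight_range hg))
  rw [or_iff_not_imp_left]
  intro hP0
  obtain ⟨hmul, hproj⟩ := (RG.leftRegular_isGradedSub_iff P).1 hP
  obtain ⟨m, hm, hm0⟩ := P.bot_or_exists_ne_zero.resolve_left hP0
  obtain ⟨γ, hγ⟩ := RG.exists_proj_ne_zero hm0
  obtain ⟨a, haP, ha, ha0⟩ : ∃ a ∈ P, a ∈ RG.grade γ ∧ a ≠ 0 :=
    ⟨_, hproj m hm γ, RG.proj_mem γ m, hγ⟩
  obtain ⟨c, hc⟩ := hle haP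
  replace hc : c * g = a := hc
  have hsrc : G.src ρ = G.src γ := by
    by_contra hne
    apply ha0
    have h1 : a * RG.one (G.src ρ) = a := by rw [← hc, mul_assoc, RG.mul_one' ρ g hg]
    rw [← h1]
    refine RG.mul_ne γ (G.src ρ) ?_ _ _ ha (RG.one_mem _ (G.src_src ρ))
    rw [G.tgt_src]
    exact Ne.symm hne
  obtain ⟨b, hb, hab⟩ := h.exists_mul_mul_eq ha
  have hx : g * b * a ∈ RG.grade ρ := by
    have := RG.mul_mem _ _ ((G.src_comp _ _ _).trans (G.src_inv γ)) _ _
      (RG.mul_mem _ _ (hsrc.trans (G.tgt_inv γ).symm) g b hg hb) ha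
    rwa [G.comp_inv_cancel_right ρ γ hsrc] at this
  have hcx : c * (g * b * a) = a := by rw [← mul_assoc, ← mul_assoc, hc, hab]
  have hxN : g * b * a ∈ N := hN.1.1 _ (hN.1.1 g hgN b) a
  have hga : g * b * a = g := by
    by_contra hne
    have hrange := mulLeft_range_eq_of_isGrSimpleSub hN (sub_mem hx hg) (sub_mem hxN hgN)
      (sub_ne_zero.2 hne)
    obtain ⟨d, hd⟩ : g * b * a ∈ (AddMonoidHom.mulLeft (g * b * a - g)).range := hrange ▸ hxN
    apply ha0
    rw [← hcx, ← hd, AddMonoidHom.coe_mulLeft, ← mul_assoc, mul_sub, hcx, hc, sub_self, zero_mul]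
  refine le_antisymm hle ?_
  rintro _ ⟨r, rfl⟩
  have hgP : g ∈ P := hga ▸ hmul a haP (g * b)
  exact hmul g hgP r

theorem IsRightGrSemisimple.isLeftGrSemisimple (h : RG.IsRightGrSemisimple) :
    RG.IsLeftGrSemisimple := by
  refine top_le_iff.1 (h.symm.le.trans (iSup₂_le fun N hN m hm => ?_))
  obtain ⟨s, hs⟩ := RG.exists_eq_sum_proj m
  rw [hs]
  refine AddSubgroup.sum_mem _ fun γ _ => ?_
  by_cases h0 : RG.proj γ m = 0
  · rw [h0]
    exact zero_mem _
  · have hmem := RG.proj_mem γ m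
    have hmN := ((RG.regular_isGradedSub_iff N).1 hN.1).2 m hm γ
    exact (le_iSup₂_of_le _ (h.isGrSimpleSub_mulRight_range hN hmem hmN h0) le_rfl :
      _ ≤ ⨆ (N : AddSubgroup R) (_ : RG.leftRegular.IsGrSimpleSub N), N)
      (RG.mem_mulRight_range hmem)

end GammaRing

/-- An object unital `Γ`-graded ring `R` is right gr-semisimple
if and only if it is left gr-semisimple. -/
theorem rightGrSemisimple_iff_leftGrSemisimple
    {Γ : Type u} (G : Gpd Γ) {R : Type v} [NonUnitalRing R] (RG : GammaRing G R) :
    RG.IsRightGrSemisimple ↔ RG.IsLeftGrSemisimple := by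
  refine ⟨fun h => h.isLeftGrSemisimple, fun h => ?_⟩
  exact @GammaRing.IsRightGrSemisimple.isLeftGrSemisimple Γ G.op R (NonUnitalRing.opposite R)
    RG.op h
end

section
/- Let Γ be a groupoid, D a Γ-graded division ring and M a Γ-graded right D-module. Then: (1) M is pseudo-free; (2) every pseudo-linearly independent sequence of homogeneous elements of M can be extended to a pseudo-basis of M; (3) any two pseudo-bases of M have the same cardinality. -/
set_option autoImplicit false

universe u v w x y

theorem AddSubgroup.exists_finsupp_of_mem_iSup {ι A : Type*} [AddCommGroup A]
    (S : ι → AddSubgroup A) {a : A} (ha : a ∈ ⨆ i, S i) :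
    ∃ f : ι →₀ A, (∀ i, f i ∈ S i) ∧ (f.sum fun _ x => x) = a := by
  classical
  induction ha using AddSubgroup.iSup_induction' with
  | hp i x hx =>
    refine ⟨Finsupp.single i x, fun j => ?_, by simp⟩
    by_cases h : i = j
    · subst h; simpa using hx
    · simp [Finsupp.single_eq_of_ne' h]
  | h1 => exact ⟨0, fun i => by simp, by simp⟩
  | hadd x y _ _ hx hy =>
    obtain ⟨f, hf, rfl⟩ := hx
    obtain ⟨g, hg, rfl⟩ := hy
    exact ⟨f + g, fun i => add_mem (hf i) (hg i),
      Finsupp.sum_add_index' (fun _ => rfl) (fun _ _ _ => rfl)⟩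

theorem AddSubgroup.mem_iSup_ne_of_mem {ι A : Type*} [AddCommGroup A] (S : ι → AddSubgroup A)
    {i j : ι} (hj : j ≠ i) {a : A} (ha : a ∈ S j) : a ∈ ⨆ (j : ι) (_ : j ≠ i), S j :=
  AddSubgroup.mem_iSup_of_mem j (AddSubgroup.mem_iSup_of_mem hj ha)

/-- A homogeneous component of an element of a graded subgroup lies in that subgroup. -/
theorem AddSubgroup.mem_of_add_mem_of_graded {ι A : Type*} [AddCommGroup A]
    {S : ι → AddSubgroup A} {N : AddSubgroup A} (hN : N ≤ ⨆ i, S i ⊓ N) {i : ι}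
    (hS : S i ⊓ (⨆ (j : ι) (_ : j ≠ i), S j) = ⊥) {z z' : A} (hz : z ∈ S i)
    (hz' : z' ∈ ⨆ (j : ι) (_ : j ≠ i), S j) (h : z + z' ∈ N) : z ∈ N := by
  have hle : (⨆ j, S j ⊓ N) ≤ (S i ⊓ N) ⊔ ⨆ (j : ι) (_ : j ≠ i), S j := by
    refine iSup_le fun j => ?_
    by_cases hj : j = i
    · subst hj; exact le_sup_left
    · exact fun a ha => AddSubgroup.mem_sup_right (AddSubgroup.mem_iSup_ne_of_mem S hj ha.1)
  obtain ⟨p, hp, q, hq, hpq⟩ := AddSubgroup.mem_sup.1 (hle (hN h))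
  rw [AddSubgroup.mem_inf] at hp
  have hmem : z - p ∈ S i ⊓ ⨆ (j : ι) (_ : j ≠ i), S j := by
    refine AddSubgroup.mem_inf.2 ⟨sub_mem hz hp.1, ?_⟩
    have : z - p = q - z' := by
      rw [sub_eq_sub_iff_add_eq_add, ← hpq, add_comm]
    rw [this]
    exact sub_mem hq hz'
  rw [hS, AddSubgroup.mem_bot, sub_eq_zero] at hmem
  exact hmem ▸ hp.2

theorem Gpd.comp_left_cancel_s8 {Γ : Type u} (G : Gpd Γ) {γ τ τ' : Γ} (h : G.src γ = G.tgt τ)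
    (h' : G.src γ = G.tgt τ') (heq : G.comp γ τ h = G.comp γ τ' h') : τ = τ' := by
  have key : ∀ (σ : Γ) (hσ : G.src γ = G.tgt σ) (k : G.src (G.inv γ) = G.tgt (G.comp γ σ hσ)),
      G.comp (G.inv γ) (G.comp γ σ hσ) k = σ := by
    intro σ hσ k
    rw [← G.comp_assoc (G.inv γ) γ σ (G.src_inv γ) hσ]
    have : ∀ (ε : Γ) (hε : G.src ε = G.tgt σ), ε = G.tgt σ → G.comp ε σ hε = σ := by
      rintro _ hε rfl
      exact G.id_comp σ
    exact this _ _ ((G.inv_comp γ).trans hσ)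
  have k : G.src (G.inv γ) = G.tgt (G.comp γ τ h) := by rw [G.src_inv, G.tgt_comp]
  have k' : G.src (G.inv γ) = G.tgt (G.comp γ τ' h') := by rw [G.src_inv, G.tgt_comp]
  rw [← key τ h k, ← key τ' h' k']
  congr 1

namespace GammaMod

variable {Γ : Type u} {G : Gpd Γ} {R : Type v} [NonUnitalRing R] {RG : GammaRing G R}
  {M : Type w} [AddCommGroup M] (Mod : GammaMod RG M)

/-- Scalar multiplication of a fixed module element, as an additive map. -/
def smulHom (m : M) : R →+ M := AddMonoidHom.mk' (Mod.smul m) (Mod.smul_add m)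

/-- Scalar multiplication by a fixed ring element, as an additive map. -/
def smulRightHom (a : R) : M →+ M :=
  AddMonoidHom.mk' (fun m => Mod.smul m a) fun m n => Mod.add_smul m n a

theorem smul_zero' (m : M) : Mod.smul m 0 = 0 := (Mod.smulHom m).map_zero

theorem zero_smul' (a : R) : Mod.smul 0 a = 0 := (Mod.smulRightHom a).map_zero

theorem smul_one_mul {γ : Γ} {x : M} (hx : x ∈ Mod.grade γ) (a : R) :
    Mod.smul x (RG.one (G.src γ) * a) = Mod.smul x a := by
  rw [Mod.smul_mul, Mod.smul_one γ x hx]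

theorem _root_.GammaRing.one_mul_one_mul {Γ : Type u} {G : Gpd Γ} {R : Type v} [NonUnitalRing R]
    (RG : GammaRing G R) (γ : Γ) (a : R) :
    RG.one (G.src γ) * (RG.one (G.src γ) * a) = RG.one (G.src γ) * a := by
  have h := RG.one_mul' _ _ (RG.one_mem _ (G.src_src γ))
  rw [G.tgt_src] at h
  rw [← mul_assoc, h]

theorem smul_mem_iSup_ne {γ τ : Γ} (h : G.src γ = G.tgt τ) {x : M} (hx : x ∈ Mod.grade γ) {a : R}
    (ha : a ∈ ⨆ (τ' : Γ) (_ : τ' ≠ τ), RG.grade τ') :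
    Mod.smul x a ∈ ⨆ (δ : Γ) (_ : δ ≠ G.comp γ τ h), Mod.grade δ := by
  have hle : (⨆ (τ' : Γ) (_ : τ' ≠ τ), RG.grade τ') ≤
      (⨆ (δ : Γ) (_ : δ ≠ G.comp γ τ h), Mod.grade δ).comap (Mod.smulHom x) := by
    refine iSup₂_le fun τ' hτ' b hb => ?_
    change Mod.smul x b ∈ ⨆ (δ : Γ) (_ : δ ≠ G.comp γ τ h), Mod.grade δ
    by_cases h' : G.src γ = G.tgt τ'
    · exact AddSubgroup.mem_iSup_ne_of_mem Mod.grade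
        (fun e => hτ' (G.comp_left_cancel_s8 h' h e)) (Mod.smul_mem _ _ h' _ _ hx hb)
    · rw [Mod.smul_ne _ _ h' _ _ hx hb]
      exact zero_mem _
  exact hle ha

/-- Over a graded division ring, if a graded submodule contains a nontrivial multiple of a
homogeneous element, then it contains the element. -/
theorem IsGradedSub.mem_of_smul_mem {Mod : GammaMod RG M} (hdiv : RG.IsGrDivision)
    {N : AddSubgroup M} (hN : Mod.IsGradedSub N) {γ : Γ} {x : M} (hx : x ∈ Mod.grade γ) {a : R}
    (ha : RG.one (G.src γ) * a ≠ 0) (h : Mod.smul x a ∈ N) : x ∈ N := by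
  classical
  obtain ⟨f, hf, rfl⟩ := AddSubgroup.exists_finsupp_of_mem_iSup RG.grade
    (a := a) (by rw [RG.grade_iSup]; trivial)
  obtain ⟨τ, hτs, hτ⟩ : ∃ τ ∈ f.support, RG.one (G.src γ) * f τ ≠ 0 := by
    by_contra! hcon
    exact ha (by rw [Finsupp.sum, Finset.mul_sum]; exact Finset.sum_eq_zero hcon)
  have hγτ : G.src γ = G.tgt τ := by
    by_contra hne
    exact hτ (RG.mul_ne (G.src γ) τ (by rwa [G.src_src]) _ _ (RG.one_mem _ (G.src_src γ)) (hf τ))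
  have hfτ : f τ ≠ 0 := Finsupp.mem_support_iff.1 hτs
  obtain ⟨b, -, hb, -⟩ := hdiv.2 τ _ (hf τ) hfτ
  have hmem : Mod.smul x (f τ) ∈ N := by
    rw [Finsupp.sum, ← Finset.add_sum_erase _ _ hτs, Mod.smul_add] at h
    refine AddSubgroup.mem_of_add_mem_of_graded hN.2 (Mod.grade_indep _)
      (Mod.smul_mem _ _ hγτ _ _ hx (hf τ)) (Mod.smul_mem_iSup_ne hγτ hx ?_) h
    exact sum_mem fun τ' hτ' => AddSubgroup.mem_iSup_ne_of_mem RG.grade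
      (Finset.ne_of_mem_erase hτ') (hf τ')
  have := hN.1 _ hmem b
  rwa [← Mod.smul_mul, hb, ← hγτ, Mod.smul_one γ x hx] at this

/-- The submodule generated by a set of (homogeneous) elements. -/
def span (S : Set M) : AddSubgroup M :=
  AddSubgroup.closure {m : M | ∃ x ∈ S, ∃ r : R, m = Mod.smul x r}

/-- The set of homogeneous elements. -/
def homogeneous : Set M := {m | ∃ γ, m ∈ Mod.grade γ}

variable {Mod}

theorem smul_mem_span_of_mem {S : Set M} {x : M} (hx : x ∈ S) (a : R) :
    Mod.smul x a ∈ Mod.span S :=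
  AddSubgroup.subset_closure ⟨x, hx, a, rfl⟩

theorem span_le {S : Set M} {N : AddSubgroup M} :
    Mod.span S ≤ N ↔ ∀ x ∈ S, ∀ a : R, Mod.smul x a ∈ N := by
  refine ⟨fun h x hx a => h (smul_mem_span_of_mem hx a), fun h => ?_⟩
  refine (AddSubgroup.closure_le _).2 ?_
  rintro _ ⟨x, hx, a, rfl⟩
  exact h x hx a

theorem span_mono {S T : Set M} (h : S ⊆ T) : Mod.span S ≤ Mod.span T :=
  span_le.2 fun _ hx => smul_mem_span_of_mem (h hx)

theorem smul_mem_span {S : Set M} {m : M} (hm : m ∈ Mod.span S) (a : R) :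
    Mod.smul m a ∈ Mod.span S := by
  have : Mod.span S ≤ (Mod.span S).comap (Mod.smulRightHom a) :=
    span_le.2 fun x hx b => by
      change Mod.smul (Mod.smul x b) a ∈ Mod.span S
      rw [← Mod.smul_mul]
      exact smul_mem_span_of_mem hx _
  exact this hm

theorem span_le_span {S T : Set M} (h : S ⊆ Mod.span T) : Mod.span S ≤ Mod.span T :=
  span_le.2 fun _ hx => smul_mem_span (h hx)

theorem subset_span {S : Set M} (hS : S ⊆ Mod.homogeneous) : S ⊆ Mod.span S := by
  intro x hx
  obtain ⟨γ, hγ⟩ := hS hx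
  have := smul_mem_span_of_mem (Mod := Mod) hx (RG.one (G.src γ))
  rwa [Mod.smul_one γ x hγ] at this

theorem isGradedSub_span {S : Set M} (hS : S ⊆ Mod.homogeneous) :
    Mod.IsGradedSub (Mod.span S) := by
  refine ⟨fun m hm a => smul_mem_span hm a, span_le.2 fun x hx a => ?_⟩
  obtain ⟨γ, hγ⟩ := hS hx
  have hle : (⨆ τ, RG.grade τ) ≤ (⨆ δ, Mod.grade δ ⊓ Mod.span S).comap (Mod.smulHom x) := by
    refine iSup_le fun τ b hb => ?_
    change Mod.smul x b ∈ ⨆ δ, Mod.grade δ ⊓ Mod.span S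
    by_cases h : G.src γ = G.tgt τ
    · exact AddSubgroup.mem_iSup_of_mem (G.comp γ τ h)
        ⟨Mod.smul_mem _ _ h _ _ hγ hb, smul_mem_span_of_mem hx b⟩
    · rw [Mod.smul_ne _ _ h _ _ hγ hb]
      exact zero_mem _
  exact hle (by rw [RG.grade_iSup]; trivial)

theorem exists_add_smul_of_mem_span_insert {S : Set M} {x y : M}
    (hy : y ∈ Mod.span (insert x S)) : ∃ s ∈ Mod.span S, ∃ a : R, s + Mod.smul x a = y := by
  have hle : Mod.span (insert x S) ≤ Mod.span S ⊔ (Mod.smulHom x).range := by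
    refine span_le.2 fun z hz a => ?_
    rcases hz with rfl | hz
    · exact AddSubgroup.mem_sup_right ⟨a, rfl⟩
    · exact AddSubgroup.mem_sup_left (smul_mem_span_of_mem hz a)
  obtain ⟨s, hs, _, ⟨a, rfl⟩, h⟩ := AddSubgroup.mem_sup.1 (hle hy)
  exact ⟨s, hs, a, h⟩

theorem exists_finite_of_mem_span {S : Set M} {y : M} (hy : y ∈ Mod.span S) :
    ∃ T ⊆ S, T.Finite ∧ y ∈ Mod.span T := by
  unfold span at hy
  induction hy using AddSubgroup.closure_induction with
  | mem y hy =>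
    obtain ⟨x, hx, a, rfl⟩ := hy
    exact ⟨{x}, Set.singleton_subset_iff.2 hx, Set.finite_singleton x,
      smul_mem_span_of_mem (Set.mem_singleton x) a⟩
  | zero => exact ⟨∅, Set.empty_subset _, Set.finite_empty, zero_mem _⟩
  | add y z _ _ hy hz =>
    obtain ⟨T, hTS, hT, hy⟩ := hy
    obtain ⟨T', hTS', hT', hz⟩ := hz
    exact ⟨T ∪ T', Set.union_subset hTS hTS', hT.union hT',
      add_mem (span_mono Set.subset_union_left hy) (span_mono Set.subset_union_right hz)⟩
  | neg y _ hy =>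
    obtain ⟨T, hTS, hT, hy⟩ := hy
    exact ⟨T, hTS, hT, neg_mem hy⟩

/-- The Steinitz exchange property. -/
theorem mem_span_exchange (hdiv : RG.IsGrDivision) {S : Set M} (hS : S ⊆ Mod.homogeneous)
    {x y : M} (hx : x ∈ Mod.homogeneous) (hy : y ∈ Mod.homogeneous)
    (hyx : y ∈ Mod.span (insert x S)) (hyS : y ∉ Mod.span S) : x ∈ Mod.span (insert y S) := by
  obtain ⟨s, hs, a, h⟩ := exists_add_smul_of_mem_span_insert hyx
  have hins : insert y S ⊆ Mod.homogeneous := Set.insert_subset hy hS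
  obtain ⟨γ, hγ⟩ := hx
  refine (isGradedSub_span hins).mem_of_smul_mem hdiv hγ (a := a) (fun h0 => hyS ?_) ?_
  · rw [← Mod.smul_one_mul hγ, h0, Mod.smul_zero', add_zero] at h
    exact h ▸ hs
  · rw [← eq_sub_iff_add_eq'] at h
    rw [h]
    exact sub_mem (subset_span hins (Set.mem_insert _ _)) (span_mono (Set.subset_insert _ _) hs)

variable (Mod) in
/-- A set of homogeneous elements none of which lies in the span of the others. -/
def Indep (S : Set M) : Prop :=
  S ⊆ Mod.homogeneous ∧ ∀ x ∈ S, x ∉ Mod.span (S \ {x})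

theorem Indep.subset {S T : Set M} (hT : Mod.Indep T) (h : S ⊆ T) : Mod.Indep S :=
  ⟨h.trans hT.1, fun x hx hxS => hT.2 x (h hx) (span_mono (Set.sdiff_subset_sdiff_left h) hxS)⟩

theorem Indep.insert (hdiv : RG.IsGrDivision) {S : Set M} (hS : Mod.Indep S) {x : M}
    (hx : x ∈ Mod.homogeneous) (hxS : x ∉ Mod.span S) : Mod.Indep (insert x S) := by
  refine ⟨Set.insert_subset hx hS.1, ?_⟩
  have hxS' : x ∉ S := fun h => hxS (subset_span hS.1 h)
  rintro y (rfl | hy) hmem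
  · rw [Set.insert_sdiff_of_mem _ (Set.mem_singleton y), Set.sdiff_singleton_eq_self hxS'] at hmem
    exact hxS hmem
  · have hne : x ≠ y := fun h => hxS' (h ▸ hy)
    rw [Set.insert_sdiff_of_notMem _ (by simpa using hne)] at hmem
    have := mem_span_exchange hdiv (Set.sdiff_subset.trans hS.1) hx (hS.1 hy) hmem (hS.2 y hy)
    rw [Set.insert_sdiff_singleton, Set.insert_eq_of_mem hy] at this
    exact hxS this

theorem span_eq_top_of_homogeneous_subset {S : Set M} (h : Mod.homogeneous ⊆ Mod.span S) :
    Mod.span S = ⊤ := by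
  rw [eq_top_iff, ← Mod.grade_iSup]
  exact iSup_le fun γ m hm => h ⟨γ, hm⟩

theorem maximal_indep_iff (hdiv : RG.IsGrDivision) {S : Set M} :
    Maximal Mod.Indep S ↔ Mod.Indep S ∧ Mod.span S = ⊤ := by
  refine ⟨fun h => ⟨h.prop, span_eq_top_of_homogeneous_subset fun x hx => ?_⟩, fun h => ⟨h.1, ?_⟩⟩
  · by_contra hxS
    exact hxS (subset_span h.prop.1
      (h.le_of_ge (h.prop.insert hdiv hx hxS) (Set.subset_insert x S) (Set.mem_insert x S)))
  · intro T hT hST x hx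
    by_contra hxS
    exact hT.2 x hx (span_mono (Set.subset_sdiff_singleton hST hxS) (h.2 ▸ AddSubgroup.mem_top x))

variable (Mod) in
/-- The matroid of pseudo-linearly independent sets of homogeneous elements. -/
def matroid (hdiv : RG.IsGrDivision) : IndepMatroid M :=
  IndepMatroid.ofFinitary Mod.homogeneous Mod.Indep
    ⟨Set.empty_subset _, fun x hx => hx.elim⟩
    (fun _ _ hJ h => hJ.subset h)
    (by
      intro I B hI hImax hB
      by_contra! hcon
      refine hImax ((maximal_indep_iff hdiv).2 ⟨hI, ?_⟩)
      rw [eq_top_iff, ← ((maximal_indep_iff hdiv).1 hB).2]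
      refine span_le_span fun x hx => ?_
      by_contra hxI
      exact hcon x ⟨hx, fun h => hxI (subset_span hI.1 h)⟩ (hI.insert hdiv (hB.prop.1 hx) hxI))
    (by
      intro I h
      refine ⟨fun x hx => (h {x} (by simpa using hx) (Set.finite_singleton x)).1 rfl,
        fun x hx hmem => ?_⟩
      obtain ⟨T, hTI, hT, hxT⟩ := exists_finite_of_mem_span hmem
      refine (h (insert x T) (Set.insert_subset hx (hTI.trans Set.sdiff_subset))
        (hT.insert x)).2 x (Set.mem_insert x T) ?_
      refine span_mono (Set.subset_sdiff_singleton (Set.subset_insert x T) fun hx' => ?_) hxT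
      exact (hTI hx').2 rfl)
    (fun _ hI => hI.1)

theorem exists_finsupp_of_mem_span_image {ι : Type*} {β : ι → Γ} {v : ι → M}
    (hv : ∀ i, v i ∈ Mod.grade (β i)) {T : Set ι} {m : M} (hm : m ∈ Mod.span (v '' T)) :
    ∃ a : ι →₀ R, (∀ i, RG.one (G.src (β i)) * a i = a i) ∧ (∀ i ∉ T, a i = 0) ∧
      Finsupp.liftAddHom (fun i => Mod.smulHom (v i)) a = m := by
  classical
  unfold span at hm
  induction hm using AddSubgroup.closure_induction with
  | mem y hy =>
    obtain ⟨_, ⟨i, hi, rfl⟩, r, rfl⟩ := hy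
    refine ⟨Finsupp.single i (RG.one (G.src (β i)) * r), fun j => ?_, fun j hj => ?_, ?_⟩
    · by_cases h : i = j
      · subst h; simpa using RG.one_mul_one_mul _ _
      · simp [Finsupp.single_eq_of_ne' h]
    · exact Finsupp.single_eq_of_ne' fun h => hj (h ▸ hi)
    · rw [Finsupp.liftAddHom_apply_single]
      exact Mod.smul_one_mul (hv i) r
  | zero => exact ⟨0, by simp, by simp, map_zero _⟩
  | add y z _ _ hy hz =>
    obtain ⟨a, ha, ha', rfl⟩ := hy
    obtain ⟨b, hb, hb', rfl⟩ := hz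
    exact ⟨a + b, fun i => by simp [mul_add, ha, hb],
      fun i hi => by simp [ha' i hi, hb' i hi], map_add _ _ _⟩
  | neg y _ hy =>
    obtain ⟨a, ha, ha', rfl⟩ := hy
    exact ⟨-a, fun i => by simp [ha], fun i hi => by simp [ha' i hi], map_neg _ _⟩

theorem pseudoLI_iff (hdiv : RG.IsGrDivision) {ι : Type*} {β : ι → Γ} {v : ι → M} :
    Mod.PseudoLI β v ↔
      (∀ i, v i ∈ Mod.grade (β i)) ∧ Function.Injective v ∧ Mod.Indep (Set.range v) := by
  classical
  constructor
  · rintro ⟨hv, hLI⟩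
    have hv' := fun i => (hv i).1
    have hhom : ∀ T : Set ι, v '' T ⊆ Mod.homogeneous := by
      rintro T _ ⟨i, -, rfl⟩
      exact ⟨β i, hv' i⟩
    have key : ∀ i, v i ∉ Mod.span (v '' {i}ᶜ) := by
      intro i hi
      obtain ⟨a, ha, ha', hsum⟩ := exists_finsupp_of_mem_span_image hv' hi
      have h1 : RG.one (G.src (β i)) * RG.one (G.src (β i)) = RG.one (G.src (β i)) := by
        have := RG.one_mul' _ _ (RG.one_mem _ (G.src_src (β i)))
        rwa [G.tgt_src] at this
      have h0 := hLI (a - Finsupp.single i (RG.one (G.src (β i)))) (fun j => by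
        by_cases h : i = j
        · subst h; simp [mul_sub, ha, h1]
        · simp [ha, Finsupp.single_eq_of_ne' h]) (by
        have : Finsupp.liftAddHom (fun i => Mod.smulHom (v i))
            (a - Finsupp.single i (RG.one (G.src (β i)))) = 0 := by
          rw [map_sub, hsum, Finsupp.liftAddHom_apply_single, sub_eq_zero]
          exact (Mod.smul_one _ _ (hv' i)).symm
        exact this)
      have hi0 := DFunLike.congr_fun h0 i
      rw [Finsupp.sub_apply, ha' i (by simp), Finsupp.single_eq_same, zero_sub,
        Finsupp.zero_apply, neg_eq_zero] at hi0
      exact (hv i).2 (by rw [← Mod.smul_one _ _ (hv' i), hi0, Mod.smul_zero'])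
    refine ⟨hv', fun i j hij => ?_, Set.image_univ ▸ hhom Set.univ, ?_⟩
    · by_contra hne
      refine key i (subset_span (hhom _) ⟨j, fun h => hne h.symm, hij.symm⟩)
    · rintro _ ⟨i, rfl⟩ hmem
      refine key i (span_mono ?_ hmem)
      rintro _ ⟨⟨j, rfl⟩, hj⟩
      exact ⟨j, fun h => hj (congrArg v h), rfl⟩
  · rintro ⟨hv, hinj, hind⟩
    refine ⟨fun i => ⟨hv i, fun h => hind.2 _ ⟨i, rfl⟩ (h ▸ zero_mem _)⟩, fun a ha hsum => ?_⟩
    by_contra hne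
    obtain ⟨i, hi⟩ := Finsupp.ne_iff.1 hne
    refine hind.2 _ ⟨i, rfl⟩ ((isGradedSub_span
      (Set.sdiff_subset.trans hind.1)).mem_of_smul_mem hdiv (hv i) (a := a i) (by rwa [ha i]) ?_)
    rw [Finsupp.sum, ← Finset.add_sum_erase _ _ (Finsupp.mem_support_iff.2 hi),
      add_eq_zero_iff_eq_neg] at hsum
    rw [hsum]
    refine neg_mem (sum_mem fun j hj => smul_mem_span_of_mem ?_ _)
    exact ⟨⟨j, rfl⟩, fun h => Finset.ne_of_mem_erase hj (hinj h)⟩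

theorem pseudoBasis_iff (hdiv : RG.IsGrDivision) {ι : Type*} {β : ι → Γ} {v : ι → M} :
    Mod.PseudoBasis β v ↔ (∀ i, v i ∈ Mod.grade (β i)) ∧ Function.Injective v ∧
      (Mod.matroid hdiv).matroid.IsBase (Set.range v) := by
  have hspan : AddSubgroup.closure {m : M | ∃ (i : ι) (r : R), m = Mod.smul (v i) r} =
      Mod.span (Set.range v) := by
    simp [span]
  rw [PseudoBasis, pseudoLI_iff hdiv, hspan, and_assoc, and_assoc]
  exact and_congr_right fun _ => and_congr_right fun _ => (maximal_indep_iff hdiv).symm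

theorem PseudoLI.exists_pseudoBasis_sumElim (hdiv : RG.IsGrDivision) {ι : Type*} {β : ι → Γ}
    {v : ι → M} (h : Mod.PseudoLI β v) :
    ∃ (κ : Type (max u w)) (β' : κ → Γ) (v' : κ → M),
      Mod.PseudoBasis (Sum.elim β β') (Sum.elim v v') := by
  obtain ⟨hv, hinj, hind⟩ := (pseudoLI_iff hdiv).1 h
  obtain ⟨B, hB, hvB⟩ :=
    Matroid.Indep.exists_isBase_superset (M := (Mod.matroid hdiv).matroid) (I := Set.range v) hind
  have hhom : B ⊆ Mod.homogeneous := hB.subset_ground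
  choose d hd using fun x : ULift.{u} ↥(B \ Set.range v) => hhom x.down.2.1
  refine ⟨ULift.{u} ↥(B \ Set.range v), d, fun x => x.down.1, (pseudoBasis_iff hdiv).2 ⟨?_, ?_, ?_⟩⟩
  · rintro (i | x)
    · exact hv i
    · exact hd x
  · refine hinj.sumElim (Subtype.val_injective.comp ULift.down_injective) fun i x hix => ?_
    exact x.down.2.2 ⟨i, hix⟩
  · have hr : Set.range (fun x : ULift.{u} ↥(B \ Set.range v) => x.down.1) = B \ Set.range v := by
      ext x
      exact ⟨fun ⟨y, hy⟩ => hy ▸ y.down.2, fun hx => ⟨⟨⟨x, hx⟩⟩, rfl⟩⟩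
    rwa [Set.Sum.elim_range, hr, Set.union_sdiff_cancel hvB]

theorem pseudoFree_of_isGrDivision (hdiv : RG.IsGrDivision) : Mod.PseudoFree := by
  obtain ⟨κ, β, v, h⟩ := PseudoLI.exists_pseudoBasis_sumElim (Mod := Mod) hdiv
    (β := (PEmpty.elim : PEmpty.{1} → Γ)) (v := PEmpty.elim)
    ⟨fun i => i.elim, fun a _ _ => Subsingleton.elim a 0⟩
  rw [pseudoBasis_iff hdiv] at h
  refine ⟨κ, β, v, (pseudoBasis_iff hdiv).2
    ⟨fun i => h.1 (.inr i), h.2.1.comp Sum.inr_injective, ?_⟩⟩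
  simpa only [Set.Sum.elim_range, Set.range_eq_empty, Set.empty_union] using h.2.2

theorem PseudoBasis.nonempty_equiv (hdiv : RG.IsGrDivision) {ι₁ ι₂ : Type*} {β₁ : ι₁ → Γ}
    {v₁ : ι₁ → M} {β₂ : ι₂ → Γ} {v₂ : ι₂ → M} (h₁ : Mod.PseudoBasis β₁ v₁)
    (h₂ : Mod.PseudoBasis β₂ v₂) : Nonempty (ι₁ ≃ ι₂) := by
  obtain ⟨-, hinj₁, hB₁⟩ := (pseudoBasis_iff hdiv).1 h₁
  obtain ⟨-, hinj₂, hB₂⟩ := (pseudoBasis_iff hdiv).1 h₂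
  have : (Mod.matroid hdiv).matroid.Finitary := IndepMatroid.ofFinitary_finitary ..
  obtain ⟨e⟩ := Cardinal.eq.1 (hB₁.cardinalMk_eq hB₂)
  exact ⟨(Equiv.ofInjective v₁ hinj₁).trans (e.trans (Equiv.ofInjective v₂ hinj₂).symm)⟩

end GammaMod

/-- graded modules over graded division rings are pseudo-free.
Let `D` be a `Γ`-graded division ring and `M` a `Γ`-graded right `D`-module.  Then:
(1) `M` is pseudo-free;
(2) every pseudo-linearly independent sequence of homogeneous elements of `M`
    extends to a pseudo-basis of `M`;
(3) any two pseudo-bases of `M` have the same cardinality. -/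
theorem modules_over_graded_division_ring_pseudoFree
    {Γ : Type u} (G : Gpd Γ) {D : Type v} [NonUnitalRing D] (DG : GammaRing G D)
    (hdiv : DG.IsGrDivision) {M : Type w} [AddCommGroup M] (Mod : GammaMod DG M) :
    Mod.PseudoFree ∧
    (∀ (ι : Type x) (β : ι → Γ) (v : ι → M), Mod.PseudoLI β v →
      ∃ (κ : Type (max u w)) (β' : κ → Γ) (v' : κ → M),
        Mod.PseudoBasis (Sum.elim β β') (Sum.elim v v')) ∧
    (∀ (ι₁ : Type x) (ι₂ : Type y) (β₁ : ι₁ → Γ) (v₁ : ι₁ → M)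
        (β₂ : ι₂ → Γ) (v₂ : ι₂ → M),
      Mod.PseudoBasis β₁ v₁ → Mod.PseudoBasis β₂ v₂ → Nonempty (ι₁ ≃ ι₂)) := by
  exact ⟨GammaMod.pseudoFree_of_isGrDivision hdiv,
    fun _ _ _ h => h.exists_pseudoBasis_sumElim hdiv,
    fun _ _ _ _ _ _ h₁ h₂ => h₁.nonempty_equiv hdiv h₂⟩
end
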